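/- Let p be a prime, let n >= 2 be an integer, let -1 <= i <= n-2, and let delta > 0 and C > 0 be constants. Then there exists Q >= 0 such that for every q = p^h with q >= Q, every code word c of C_n(H(2n+1,q^2))^perp with wt(c) <= delta * q^{2n-1}, and every n-dimensional projective subspace pi of PG(2n+1,q^2) such that pi intersect pi^sigma has projective dimension i, the following holds: writing S = supp(c), x = the number of points of S lying on pi but not on pi intersect pi^sigma, and t = the number of points of S lying on pi^sigma but not on pi intersect pi^sigma, either x + t <= C * q^{2n-1} or x + t >= Sigma_{n,i} - C * q^{2n-1}. -/

import Mathlib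

open scoped BigOperators

namespace HermCode

/-- The Hermitian sesquilinear form `h(x,y) = ∑ᵢ xᵢ * yᵢ^q` on `F^m`. -/
def herm (q : ℕ) {F : Type} [Field F] {m : ℕ} (x y : Fin m → F) : F :=
  ∑ i, x i * (y i) ^ q

/-- For a fixed vector `x`, the linear map `y ↦ h(y,x)`. -/
def hermL (q : ℕ) {F : Type} [Field F] {m : ℕ} (x : Fin m → F) :
    (Fin m → F) →ₗ[F] F where
  toFun y := herm q y x
  map_add' a b := by
    simp [herm, add_mul, Finset.sum_add_distrib]
  map_smul' c a := by
    simp [herm, Finset.mul_sum, mul_assoc]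

/-- The image `W^σ` of a subspace `W` under the Hermitian polarity `σ`:
the subspace of all vectors orthogonal to every vector of `W`
with respect to the Hermitian form. -/
def polar (q : ℕ) {F : Type} [Field F] {m : ℕ} (W : Submodule F (Fin m → F)) :
    Submodule F (Fin m → F) :=
  ⨅ x : W, LinearMap.ker (hermL q (x : Fin m → F))

/-- A subspace all of whose points lie on the Hermitian variety. -/
def TotallyIsotropic (q : ℕ) {F : Type} [Field F] {m : ℕ}
    (W : Submodule F (Fin m → F)) : Prop :=
  ∀ x ∈ W, herm q x x = 0

/-- A point of the Hermitian variety: a projective point (1-dimensional subspace)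
spanned by an isotropic vector. -/
def IsHermPoint (q : ℕ) {F : Type} [Field F] {m : ℕ}
    (P : Submodule F (Fin m → F)) : Prop :=
  Module.finrank F P = 1 ∧ TotallyIsotropic q P

/-- A generator of `H(2n+1,q²)`: an `n`-dimensional projective subspace all of
whose points lie on the Hermitian variety. -/
def IsGenerator (q n : ℕ) {F : Type} [Field F]
    (W : Submodule F (Fin (2*n+2) → F)) : Prop :=
  Module.finrank F W = n + 1 ∧ TotallyIsotropic q W

/-- A code word of the dual code `C_n(H(2n+1,q²))^⊥`: a function from points to `F_p`
(vanishing off the Hermitian variety) summing to zero over every generator. -/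
def IsCodeword (p q n : ℕ) {F : Type} [Field F]
    (c : Submodule F (Fin (2*n+2) → F) → ZMod p) : Prop :=
  (∀ P, ¬ IsHermPoint q P → c P = 0) ∧
  ∀ μ, IsGenerator q n μ → (∑ᶠ P ∈ {P | IsHermPoint q P ∧ P ≤ μ}, c P) = 0

/-- The (Hamming) weight of a code word. -/
noncomputable def wt {p : ℕ} {α : Type*} (c : α → ZMod p) : ℕ :=
  Nat.card {x : α // c x ≠ 0}

open scoped Classical in
/-- The incidence vector `v_π` of `π ∩ H`. -/
noncomputable def vsub (p q : ℕ) {F : Type} [Field F] {m : ℕ}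
    (π : Submodule F (Fin m → F)) : Submodule F (Fin m → F) → ZMod p :=
  fun P => if IsHermPoint q P ∧ P ≤ π then 1 else 0

/-- `θ_m(q)`, the number of points of `PG(m,q)`. -/
noncomputable def theta (q : ℕ) (m : ℤ) : ℚ :=
  ((q:ℚ)^(m+1) - 1) / ((q:ℚ) - 1)

/-- `μ_m(q²)`, the number of points of `H(m,q²)` (with `μ_{-1} = 0`). -/
noncomputable def muH (q : ℕ) (m : ℤ) : ℚ :=
  (((q:ℚ)^(m+1) - (-1:ℚ)^(m+1)) * ((q:ℚ)^m - (-1:ℚ)^m)) / ((q:ℚ)^2 - 1)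

/-- The number `N(n,i)`. -/
noncomputable def NN (q n : ℕ) (i : ℤ) : ℚ :=
  (q:ℚ)^(((n:ℤ)-1)^2 - ((((n:ℤ)-i-1).toNat.choose 2 : ℕ) : ℤ)) *
    ∏ j ∈ Finset.range ((n:ℤ)-i-2).toNat, ((q:ℚ)^(j+1) - (-1:ℚ)^(j+1))

open scoped Classical in
/-- The quantity `Σ_{n,i}`. -/
noncomputable def SigmaNI (q n : ℕ) (i : ℤ) : ℚ :=
  if Odd ((n:ℤ) - i) then
    2*(q:ℚ)^(2*i+2) * muH q ((n:ℤ)-i-1)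
      + 4 * muH q ((n:ℤ)-i-2) * ((q:ℚ)^((n:ℤ)-i-1) - 1)
          / ((q:ℚ)^((n:ℤ)-3*i-5) * ((q:ℚ)^2 - 1))
  else
    2*(q:ℚ)^(2*i+2) * (muH q ((n:ℤ)-i-1)
      + 2*((q:ℚ)^(4:ℤ) * muH q ((n:ℤ)-i-3) + (q:ℚ)^2 - 1)/((q:ℚ)^2 - 1))

/-- `P` lies on a projective line entirely contained in the Hermitian variety that
meets both `π \ (π ⊓ π^σ)` and `π^σ \ (π ⊓ π^σ)`. -/
def OnGoodLine (q : ℕ) {F : Type} [Field F] {m : ℕ}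
    (π P : Submodule F (Fin m → F)) : Prop :=
  ∃ A B : Submodule F (Fin m → F),
    Module.finrank F A = 1 ∧ A ≤ π ∧ ¬ A ≤ π ⊓ polar q π ∧
    Module.finrank F B = 1 ∧ B ≤ polar q π ∧ ¬ B ≤ π ⊓ polar q π ∧
    P ≤ A ⊔ B ∧ TotallyIsotropic q (A ⊔ B)

set_option linter.unusedSectionVars false
set_option linter.unusedVariables false

section Form

variable {q : ℕ} {F : Type} [Field F] [Fintype F] {m : ℕ}

/-- The standing assumptions on `q` and `F`. -/
structure Good (q : ℕ) (F : Type) [Field F] [Fintype F] : Prop where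
  card : Fintype.card F = q ^ 2
  add : ∀ x y : F, (x + y) ^ q = x ^ q + y ^ q
  five : 5 ≤ q

theorem Good.pp (g : Good q F) (x : F) : (x ^ q) ^ q = x := by
  rw [← pow_mul, ← sq, ← g.card, FiniteField.pow_card]

theorem Good.q0 (g : Good q F) : q ≠ 0 := by have := g.five; omega

/-- the Frobenius ring hom -/
def frob (g : Good q F) : F →+* F where
  toFun x := x ^ q
  map_one' := one_pow _
  map_mul' x y := mul_pow _ _ _
  map_zero' := zero_pow g.q0
  map_add' := g.add

theorem Good.sum (g : Good q F) {ι : Type*} (s : Finset ι) (f : ι → F) :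
    (∑ i ∈ s, f i) ^ q = ∑ i ∈ s, (f i) ^ q := map_sum (frob g) f s

theorem Good.neg (g : Good q F) (x : F) : (-x) ^ q = - x ^ q := map_neg (frob g) x

theorem Good.inj (g : Good q F) {x y : F} (h : x ^ q = y ^ q) : x = y := (frob g).injective h

theorem herm_add_left (x y z : Fin m → F) : herm q (x + y) z = herm q x z + herm q y z :=
  (hermL q z).map_add x y

theorem herm_smul_left (a : F) (x z : Fin m → F) : herm q (a • x) z = a * herm q x z :=
  (hermL q z).map_smul a x

theorem herm_swap (g : Good q F) (x y : Fin m → F) : herm q y x = (herm q x y) ^ q := by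
  simp only [herm, g.sum, mul_pow, g.pp]
  exact Finset.sum_congr rfl fun i _ => mul_comm _ _

theorem herm_zero_swap (g : Good q F) {x y : Fin m → F} (h : herm q x y = 0) :
    herm q y x = 0 := by rw [herm_swap g, h, zero_pow g.q0]

theorem herm_add_right (g : Good q F) (x y z : Fin m → F) :
    herm q x (y + z) = herm q x y + herm q x z := by
  rw [herm_swap g, herm_add_left, g.add, ← herm_swap g, ← herm_swap g]

theorem herm_smul_right (g : Good q F) (a : F) (x z : Fin m → F) :
    herm q x (a • z) = a ^ q * herm q x z := by
  rw [herm_swap g, herm_smul_left, mul_pow, ← herm_swap g]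

theorem mem_polar {W : Submodule F (Fin m → F)} {y : Fin m → F} :
    y ∈ polar q W ↔ ∀ x ∈ W, herm q y x = 0 := by
  simp only [polar, Submodule.mem_iInf, LinearMap.mem_ker, Subtype.forall]
  exact Iff.rfl

theorem polar_anti {W U : Submodule F (Fin m → F)} (h : W ≤ U) : polar q U ≤ polar q W :=
  fun _ hy => mem_polar.2 fun x hx => mem_polar.1 hy x (h hx)

theorem le_polar_polar (g : Good q F) (W : Submodule F (Fin m → F)) : W ≤ polar q (polar q W) :=
  fun _ hw => mem_polar.2 fun _ hx => herm_zero_swap g (mem_polar.1 hx _ hw)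

theorem polar_sup (g : Good q F) (W U : Submodule F (Fin m → F)) :
    polar q (W ⊔ U) = polar q W ⊓ polar q U := by
  apply le_antisymm
  · exact le_inf (polar_anti le_sup_left) (polar_anti le_sup_right)
  · rintro y ⟨h1, h2⟩
    refine mem_polar.2 fun x hx => ?_
    obtain ⟨a, ha, b, hb, rfl⟩ := Submodule.mem_sup.1 hx
    rw [herm_add_right g, mem_polar.1 h1 a ha, mem_polar.1 h2 b hb, add_zero]

theorem card_sub (g : Good q F) (W : Submodule F (Fin m → F)) :
    Nat.card W = q ^ (2 * Module.finrank F W) := by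
  rw [Module.natCard_eq_pow_finrank (K := F), Nat.card_eq_fintype_card, g.card, ← pow_mul]

/-- conjugate subspace -/
def conj (g : Good q F) (W : Submodule F (Fin m → F)) : Submodule F (Fin m → F) where
  carrier := {y | ∃ x ∈ W, y = fun i => x i ^ q}
  zero_mem' := ⟨0, W.zero_mem, by ext i; simp [zero_pow g.q0]⟩
  add_mem' := by
    rintro _ _ ⟨x, hx, rfl⟩ ⟨y, hy, rfl⟩
    exact ⟨x + y, W.add_mem hx hy, by ext i; simp [g.add]⟩
  smul_mem' := by
    rintro a _ ⟨x, hx, rfl⟩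
    exact ⟨a ^ q • x, W.smul_mem _ hx, by ext i; simp [mul_pow, g.pp]⟩

theorem finrank_conj (g : Good q F) (W : Submodule F (Fin m → F)) :
    Module.finrank F (conj g W) = Module.finrank F W := by
  have h : Nat.card W = Nat.card (conj g W) := by
    refine Nat.card_congr (Equiv.ofBijective
      (fun x => ⟨fun i => x.1 i ^ q, x.1, x.2, rfl⟩) ⟨?_, ?_⟩)
    · rintro ⟨x, hx⟩ ⟨y, hy⟩ h
      ext i
      have h' := congrFun (congrArg Subtype.val h) i
      exact g.inj h'
    · rintro ⟨_, x, hx, rfl⟩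
      exact ⟨⟨x, hx⟩, rfl⟩
  rw [card_sub g, card_sub g] at h
  have := Nat.pow_right_injective (by have := g.five; omega) h
  omega

theorem finrank_polar (g : Good q F) (W : Submodule F (Fin m → F)) :
    Module.finrank F W + Module.finrank F (polar q W) = m := by
  have hn : (dotProductBilin F F : (Fin m → F) →ₗ[F] (Fin m → F) →ₗ[F] F).Nondegenerate := by
    constructor
    · intro x hx
      exact dotProduct_eq_zero x (fun w => by simpa using hx w)
    · intro x hx
      exact dotProduct_eq_zero x (fun w => by rw [dotProduct_comm]; simpa using hx w)
  have h := LinearMap.BilinForm.finrank_orthogonal hn (conj g W)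
  have he : polar q W = LinearMap.BilinForm.orthogonal (dotProductBilin F F) (conj g W) := by
    ext y
    rw [mem_polar, LinearMap.BilinForm.mem_orthogonal_iff]
    constructor
    · rintro h _ ⟨x, hx, rfl⟩
      have := h x hx
      show dotProductBilin F F _ _ = 0
      simp only [dotProductBilin_apply_apply]
      rw [dotProduct_comm]
      exact this
    · intro h x hx
      have := h _ ⟨x, hx, rfl⟩
      change dotProductBilin F F _ _ = 0 at this
      simp only [dotProductBilin_apply_apply] at this
      rw [dotProduct_comm] at this
      exact this
  rw [he, h, finrank_conj g]
  have := Submodule.finrank_le W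
  simp at this ⊢
  omega

theorem polar_polar (g : Good q F) (W : Submodule F (Fin m → F)) : polar q (polar q W) = W := by
  refine (Submodule.eq_of_le_of_finrank_eq (le_polar_polar g W) ?_).symm
  have := finrank_polar g W
  have := finrank_polar g (polar q W)
  omega

end Form

section Counting

open scoped Classical

variable {q : ℕ} {F : Type} [Field F] [Fintype F] {m : ℕ}

theorem card_roots_le (g : Good q F) (c : F) :
    (Finset.univ.filter fun x : F => x ^ q = c * x).card ≤ q := by
  have h5 := g.five
  set P : Polynomial F := Polynomial.X ^ q - Polynomial.C c * Polynomial.X with hP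
  have hd : P.natDegree = q := by
    rw [hP, Polynomial.natDegree_sub_eq_left_of_natDegree_lt]
    · simp
    · refine lt_of_le_of_lt (Polynomial.natDegree_C_mul_le c _) ?_
      simp; omega
  have hP0 : P ≠ 0 := by
    intro h; rw [h] at hd; simp at hd; omega
  calc _ ≤ P.roots.toFinset.card := by
        apply Finset.card_le_card
        intro x hx
        simp only [Finset.mem_filter, Finset.mem_univ, true_and] at hx
        rw [Multiset.mem_toFinset, Polynomial.mem_roots hP0]
        simp [hP, hx]
    _ ≤ P.roots.card := Multiset.toFinset_card_le _
    _ ≤ q := by rw [← hd]; exact Polynomial.card_roots' P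

/-- trace map -/
def tr (g : Good q F) : F →+ F where
  toFun x := x + x ^ q
  map_zero' := by simp [zero_pow g.q0]
  map_add' x y := by rw [g.add]; ring

theorem card_tr (g : Good q F) :
    Nat.card (tr g).ker = q ∧ ∀ d : F, d ^ q = d → ∃ a, tr g a = d := by
  have h5 := g.five
  have h1 : Nat.card (tr g).ker ≤ q := by
    refine le_trans ?_ (card_roots_le g (-1))
    rw [← Fintype.card_subtype, ← Nat.card_eq_fintype_card]
    refine Nat.card_le_card_of_injective
      (fun x => ⟨x.1, ?_⟩) ?_
    · have : x.1 + x.1 ^ q = 0 := x.2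
      linear_combination this
    · intro x y h
      have h := congrArg Subtype.val h
      exact Subtype.ext h
  have hsub : ((tr g).range : Set F) ⊆
      (Finset.univ.filter fun x : F => x ^ q = 1 * x : Finset F) := by
    rintro _ ⟨a, rfl⟩
    simp only [Finset.coe_filter, Finset.mem_univ, true_and, Set.mem_ofPred_eq, one_mul]
    show (a + a ^ q) ^ q = a + a ^ q
    rw [g.add, g.pp, add_comm]
  have h2' := card_roots_le g (1 : F)
  have h2 : Nat.card (tr g).range ≤
      (Finset.univ.filter fun x : F => x ^ q = 1 * x).card := by
    have := Set.ncard_le_ncard hsub (Finset.finite_toSet _)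
    rwa [Set.ncard_coe_finset] at this
  have h3 : Nat.card (tr g).range * Nat.card (tr g).ker = q ^ 2 := by
    rw [← g.card, ← Nat.card_eq_fintype_card, ← AddSubgroup.index_ker, mul_comm]
    exact AddSubgroup.card_mul_index _
  have h4 : Nat.card (tr g).ker = q := by nlinarith
  refine ⟨h4, fun d hd => ?_⟩
  have h6 : Nat.card (tr g).range = q := by
    rw [h4] at h3; nlinarith
  have h7 : ((tr g).range : Set F) =
      (Finset.univ.filter fun x : F => x ^ q = 1 * x : Finset F) := by
    apply Set.eq_of_subset_of_ncard_le hsub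
    rw [Set.ncard_coe_finset]
    exact h2'.trans h6.ge
  have : d ∈ ((tr g).range : Set F) := by rw [h7]; simp [hd]
  exact this

theorem card_tr_fiber (g : Good q F) {b d : F} (hb : b ≠ 0) (hd : d ^ q = d) :
    (Finset.univ.filter fun a : F => a * b + (a * b) ^ q = d).card = q := by
  obtain ⟨h1, h2⟩ := card_tr g
  obtain ⟨a0, ha0⟩ := h2 d hd
  have ha0 : a0 + a0 ^ q = d := ha0
  rw [← Fintype.card_subtype, ← Nat.card_eq_fintype_card]
  refine Eq.trans ?_ h1
  refine Nat.card_congr (Equiv.ofBijective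
    (fun x => ⟨x.1 * b - a0, ?_⟩) ⟨?_, ?_⟩)
  · have := x.2
    show (x.1 * b - a0) + (x.1 * b - a0) ^ q = 0
    rw [sub_eq_add_neg, g.add, g.neg]
    linear_combination this - ha0
  · intro x y h
    have h := congrArg Subtype.val h
    simp only [sub_left_inj, mul_eq_mul_right_iff, hb, or_false] at h
    exact Subtype.ext h
  · rintro ⟨y, hy⟩
    have hy : y + y ^ q = 0 := hy
    refine ⟨⟨(y + a0) / b, ?_⟩, ?_⟩
    · rw [div_mul_cancel₀ _ hb, g.add]
      linear_combination hy + ha0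
    · apply Subtype.ext
      simp [div_mul_cancel₀ _ hb]

theorem norm_surj (g : Good q F) {y : F} (hy : y ^ q = y) (h0 : y ≠ 0) :
    ∃ a : F, a * a ^ q = y := by
  have h5 := g.five
  obtain ⟨γ, hγ⟩ := IsCyclic.exists_generator (α := Fˣ)
  obtain ⟨k, hk⟩ := Subgroup.mem_zpowers_iff.1 (hγ (Units.mk0 y h0))
  have ho : orderOf γ = (q + 1) * (q - 1) := by
    rw [orderOf_eq_card_of_forall_mem_zpowers hγ, Nat.card_eq_fintype_card,
      Fintype.card_units, g.card]
    obtain ⟨r, rfl⟩ : ∃ r, q = r + 1 := ⟨q - 1, by omega⟩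
    simp; ring_nf; omega
  have h1 : (Units.mk0 y h0) ^ (q - 1) = 1 := by
    ext
    simp only [Units.val_pow_eq_pow_val, Units.val_mk0, Units.val_one]
    have : y ^ (q - 1) * y = 1 * y := by
      rw [← pow_succ, Nat.sub_add_cancel (by omega), hy, one_mul]
    exact mul_right_cancel₀ h0 this
  rw [← hk, ← zpow_natCast, ← zpow_mul, ← orderOf_dvd_iff_zpow_eq_one, ho] at h1
  push_cast [Nat.cast_sub (show 1 ≤ q by omega)] at h1
  have h2 : ((q : ℤ) + 1) ∣ k := by
    refine Int.dvd_of_mul_dvd_mul_right (a := (q : ℤ) - 1) ?_ h1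
    omega
  obtain ⟨l, rfl⟩ := h2
  refine ⟨((γ ^ l : Fˣ) : F), ?_⟩
  have : (γ ^ l) * (γ ^ l) ^ q = Units.mk0 y h0 := by
    rw [← hk, ← zpow_natCast, ← zpow_mul, ← zpow_add]
    congr 1; ring
  have := congrArg Units.val this
  simpa using this

theorem herm_expand (g : Good q F) (a : F) (x y : Fin m → F) :
    herm q (a • x + y) (a • x + y) =
      a * a ^ q * herm q x x + (a * herm q x y + (a * herm q x y) ^ q) + herm q y y := by
  simp only [herm_add_left, herm_add_right g, herm_smul_left, herm_smul_right g, mul_pow]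
  rw [herm_swap g x y]
  ring

theorem herm_self (g : Good q F) (x : Fin m → F) : herm q x x ^ q = herm q x x :=
  (herm_swap g x x).symm

theorem ti_le_polar (g : Good q F) {W : Submodule F (Fin m → F)} (h : TotallyIsotropic q W) :
    W ≤ polar q W := by
  intro x hx
  refine mem_polar.2 fun y hy => ?_
  by_contra hb
  have h1 := card_tr_fiber g hb (d := 0) (zero_pow g.q0)
  rw [Finset.filter_true_of_mem, Finset.card_univ, g.card] at h1
  · have := g.five; nlinarith
  · intro a _
    have := herm_expand g a x y
    rw [h _ (W.add_mem (W.smul_mem a hx) hy), h _ hx, h _ hy] at this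
    simpa using this.symm

theorem ti_of_le_polar {W : Submodule F (Fin m → F)} (h : W ≤ polar q W) :
    TotallyIsotropic q W := fun x hx => mem_polar.1 (h hx) x hx

theorem exists_iso (g : Good q F) {U : Submodule F (Fin m → F)}
    (h : Module.finrank F ↥(U ⊓ polar q U) + 2 ≤ Module.finrank F U) :
    ∃ e ∈ U, herm q e e = 0 ∧ e ∉ polar q U := by
  obtain ⟨v, hv, hvv⟩ : ∃ v ∈ U, herm q v v ≠ 0 := by
    by_contra! hc
    have := ti_le_polar g hc
    rw [inf_eq_left.2 this] at h
    omega
  have hlt : ¬ (U ⊓ polar q (Submodule.span F {v}) ≤ U ⊓ polar q U) := by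
    intro hle
    have h1 := Submodule.finrank_mono hle
    have h2 := finrank_polar g (Submodule.span F {v})
    have h3 : Module.finrank F (Submodule.span F {v}) ≤ 1 := (finrank_span_le_card {v}).trans (by simp)
    have h4 := Submodule.finrank_sup_add_finrank_inf_eq U (polar q (Submodule.span F {v}))
    have h5 := Submodule.finrank_le (U ⊔ polar q (Submodule.span F {v}))
    simp only [Module.finrank_fintype_fun_eq_card, Fintype.card_fin] at h5
    omega
  obtain ⟨w, ⟨hwU, hwv⟩, hw⟩ := SetLike.not_le_iff_exists.1 hlt
  have hwp : w ∉ polar q U := fun hh => hw ⟨hwU, hh⟩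
  by_cases hww : herm q w w = 0
  · exact ⟨w, hwU, hww, hwp⟩
  have hwv : herm q w v = 0 := mem_polar.1 hwv v (Submodule.mem_span_singleton_self v)
  obtain ⟨a, ha⟩ := norm_surj g (y := - herm q v v / herm q w w)
    (by rw [div_pow, g.neg, herm_self g, herm_self g]) (div_ne_zero (neg_ne_zero.2 hvv) hww)
  refine ⟨a • w + v, U.add_mem (U.smul_mem a hwU) hv, ?_, ?_⟩
  · rw [herm_expand g, ha, hwv, div_mul_cancel₀ _ hww]
    simp [zero_pow g.q0]
  · intro hh
    have := mem_polar.1 hh v hv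
    rw [herm_add_left, herm_smul_left, hwv] at this
    simp at this
    exact hvv this

theorem card_mem (g : Good q F) (W : Submodule F (Fin m → F)) :
    (Finset.univ.filter fun v => v ∈ W).card = q ^ (2 * Module.finrank F W) := by
  rw [← card_sub g, ← Fintype.card_subtype, ← Nat.card_eq_fintype_card]

theorem card_iso_aux (g : Good q F) {U : Submodule F (Fin m → F)} {e : Fin m → F}
    (he : e ∈ U) (hee : herm q e e = 0) :
    (Finset.univ.filter fun v => v ∈ U ∧ herm q v v = 0 ∧ herm q v e ≠ 0).card * q =
    (Finset.univ.filter fun v => v ∈ U ∧ herm q v e ≠ 0).card := by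
  have h5 := g.five
  set A := (Finset.univ.filter fun v => v ∈ U ∧ herm q v v = 0 ∧ herm q v e ≠ 0) with hA
  set B := (Finset.univ.filter fun v => v ∈ U ∧ herm q v e ≠ 0) with hB
  have h1 := Finset.sum_card_bipartiteAbove_eq_sum_card_bipartiteBelow
    (s := B) (t := (Finset.univ : Finset F)) (fun v a => a • e + v ∈ A)
  have hx : ∀ (a : F) v, herm q (a • e + v) e = herm q v e := by
    intro a v; rw [herm_add_left, herm_smul_left, hee]; simp
  have h2 : ∀ v ∈ B, (Finset.univ.bipartiteAbove (fun v (a : F) => a • e + v ∈ A) v).card = q := by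
    intro v hv
    simp only [hB, Finset.mem_filter, Finset.mem_univ, true_and] at hv
    have hne : herm q e v ≠ 0 := fun h => hv.2 (herm_zero_swap g h)
    rw [← card_tr_fiber g hne (d := - herm q v v) (by rw [g.neg, herm_self g])]
    congr 1
    ext a
    simp only [Finset.bipartiteAbove, hA, Finset.mem_filter, Finset.mem_univ, true_and, hx]
    rw [herm_expand g, hee]
    constructor
    · rintro ⟨_, h, _⟩
      linear_combination h
    · intro h
      exact ⟨U.add_mem (U.smul_mem a he) hv.1, by linear_combination h, hv.2⟩
  have h3 : ∀ a ∈ (Finset.univ : Finset F),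
      (B.bipartiteBelow (fun v (a : F) => a • e + v ∈ A) a).card = A.card := by
    intro a _
    refine Finset.card_bij (fun v _ => a • e + v) ?_ ?_ ?_
    · intro v hv
      exact (Finset.mem_filter.1 hv).2
    · intro v _ w _ h
      exact add_left_cancel h
    · intro w hw
      refine ⟨w - a • e, ?_, by simp⟩
      refine Finset.mem_filter.2 ⟨?_, by simpa using hw⟩
      simp only [hA, hB, Finset.mem_filter, Finset.mem_univ, true_and] at hw ⊢
      refine ⟨U.sub_mem hw.1 (U.smul_mem a he), ?_⟩
      have := hx a (w - a • e)
      rw [← this]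
      simpa using hw.2.2
  rw [Finset.sum_congr rfl h2, Finset.sum_congr rfl h3] at h1
  simp only [Finset.sum_const, smul_eq_mul, Finset.card_univ, g.card] at h1
  have : q * (A.card * q) = q * B.card := by nlinarith
  exact Nat.eq_of_mul_eq_mul_left (by omega) this

theorem card_nonperp (g : Good q F) {U : Submodule F (Fin m → F)} {e : Fin m → F}
    (hp : e ∉ polar q U) :
    ∃ d, Module.finrank F U = d + 1 ∧
    (Finset.univ.filter fun v => v ∈ U ∧ herm q v e = 0).card = q ^ (2 * d) ∧
    (Finset.univ.filter fun v => v ∈ U ∧ herm q v e ≠ 0).card + q ^ (2 * d) = q ^ (2 * d + 2) := by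
  have h1 : ∃ u ∈ U, herm q u e ≠ 0 := by
    by_contra! hc
    exact hp (mem_polar.2 fun x hx => herm_zero_swap g (hc x hx))
  obtain ⟨u, hu, hue⟩ := h1
  set f : U →ₗ[F] F := (hermL q e).comp U.subtype with hf
  have hsurj : Function.Surjective f := by
    apply LinearMap.surjective
    intro h
    exact hue (by have := LinearMap.congr_fun h ⟨u, hu⟩; exact this)
  have h2 := f.finrank_range_add_finrank_ker
  rw [LinearMap.range_eq_top.2 hsurj, finrank_top, Module.finrank_self] at h2
  refine ⟨Module.finrank F (LinearMap.ker f), by omega, ?_⟩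
  have h3 : (Finset.univ.filter fun v => v ∈ U ∧ herm q v e = 0).card
      = q ^ (2 * Module.finrank F (LinearMap.ker f)) := by
    have : Module.finrank F (LinearMap.ker f)
        = Module.finrank F ((LinearMap.ker f).map U.subtype) :=
      (LinearEquiv.finrank_eq (Submodule.equivMapOfInjective _ U.injective_subtype _))
    rw [this, ← card_mem g]
    congr 1
    ext v
    simp only [Finset.mem_filter, Finset.mem_univ, true_and, Submodule.mem_map, LinearMap.mem_ker]
    constructor
    · rintro ⟨h1, h2⟩
      exact ⟨⟨v, h1⟩, h2, rfl⟩
    · rintro ⟨⟨w, h1⟩, h2, rfl⟩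
      exact ⟨h1, h2⟩
  refine ⟨h3, ?_⟩
  have h4 := card_mem g U
  rw [← h3, add_comm]
  have h5 : 2 * Module.finrank F (LinearMap.ker f) + 2 = 2 * Module.finrank F U := by omega
  rw [h5, ← h4, ← Finset.card_filter_add_card_filter_not (s := Finset.univ.filter fun v => v ∈ U)
    (fun v => herm q v e = 0), Finset.filter_filter, Finset.filter_filter]

/-- Bounds for the number of isotropic vectors. -/
theorem iso_bounds (g : Good q F) {U : Submodule F (Fin m → F)} {d : ℕ}
    (hd : Module.finrank F U = d + 2)
    (h : Module.finrank F ↥(U ⊓ polar q U) ≤ d) :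
    q ^ (2 * d + 3) ≤ q ^ (2 * d + 1) +
      (Finset.univ.filter fun v => v ∈ U ∧ v ∉ polar q U ∧ herm q v v = 0).card ∧
    (Finset.univ.filter fun v => v ∈ U ∧ herm q v v = 0).card ≤ q ^ (2 * d + 3) + q ^ (2 * d + 2) := by
  have h5 := g.five
  obtain ⟨e, he, hee, hp⟩ := exists_iso g (U := U) (by omega)
  obtain ⟨d', h1, h2, h3⟩ := card_nonperp g hp
  have h4 := card_iso_aux g he hee
  obtain rfl : d' = d + 1 := by omega
  set A := (Finset.univ.filter fun v => v ∈ U ∧ herm q v v = 0 ∧ herm q v e ≠ 0) with hA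
  have h6 : A.card + q ^ (2 * d + 1) = q ^ (2 * d + 3) := by
    apply Nat.eq_of_mul_eq_mul_right (show 0 < q by omega)
    rw [add_mul, h4, ← pow_succ, ← pow_succ]
    exact h3
  constructor
  · rw [← h6, add_comm]
    refine Nat.add_le_add_left (Finset.card_le_card fun v hv => ?_) _
    simp only [hA, Finset.mem_filter, Finset.mem_univ, true_and] at hv ⊢
    obtain ⟨h1, h2, h3⟩ := hv
    exact ⟨h1, fun hh => h3 (mem_polar.1 hh e he), h2⟩
  · have h7 : (Finset.univ.filter fun v => v ∈ U ∧ herm q v v = 0) ⊆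
        A ∪ (Finset.univ.filter fun v => v ∈ U ∧ herm q v e = 0) := by
      intro v hv
      simp only [hA, Finset.mem_union, Finset.mem_filter, Finset.mem_univ, true_and] at hv ⊢
      tauto
    have h8 := (Finset.card_le_card h7).trans (Finset.card_union_le _ _)
    rw [h2] at h8
    have : 2 * (d + 1) = 2 * d + 2 := by ring
    rw [this] at h8
    omega


noncomputable instance subFintype : Fintype (Submodule F (Fin m → F)) :=
  haveI : Finite (Submodule F (Fin m → F)) := Finite.of_injective _ SetLike.coe_injective
  Fintype.ofFinite _

/-- number of subspaces with property `G` containing `W` -/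
noncomputable def cnt (G : Submodule F (Fin m → F) → Prop) (W : Submodule F (Fin m → F)) : ℕ :=
  (Finset.univ.filter fun μ => G μ ∧ W ≤ μ).card

theorem gen_rec (g : Good q F) {n k : ℕ} (G : Submodule F (Fin (2*n+2) → F) → Prop)
    (hG : ∀ μ, G μ → IsGenerator q n μ) (W : Submodule F (Fin (2*n+2) → F))
    (hk : Module.finrank F W = k) :
    cnt G W * (q ^ (2*n+2) - q ^ (2*k)) =
    ∑ v ∈ Finset.univ.filter (fun v => v ∈ polar q W ∧ v ∉ W ∧ herm q v v = 0),
      cnt G (W ⊔ Submodule.span F {v}) := by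
  unfold cnt
  have h1 := Finset.sum_card_bipartiteAbove_eq_sum_card_bipartiteBelow
    (s := Finset.univ.filter fun μ => G μ ∧ W ≤ μ)
    (t := Finset.univ.filter (fun v => v ∈ polar q W ∧ v ∉ W ∧ herm q v v = 0))
    (fun μ v => v ∈ μ)
  have h2 : ∀ μ ∈ Finset.univ.filter (fun μ => G μ ∧ W ≤ μ),
      ((Finset.univ.filter (fun v => v ∈ polar q W ∧ v ∉ W ∧ herm q v v = 0)).bipartiteAbove
        (fun (μ : Submodule F (Fin (2*n+2) → F)) v => v ∈ μ) μ).card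
        = q ^ (2*n+2) - q ^ (2*k) := by
    intro μ hμ
    simp only [Finset.mem_filter, Finset.mem_univ, true_and] at hμ
    obtain ⟨hd, ht⟩ := hG μ hμ.1
    have e1 : q ^ (2*n+2) = q ^ (2 * Module.finrank F μ) := by rw [hd]; ring
    rw [e1, ← hk, ← card_mem g, ← card_mem g, ← Finset.card_sdiff_of_subset]
    · congr 1
      ext v
      simp only [Finset.bipartiteAbove, Finset.mem_filter, Finset.mem_univ, true_and,
        Finset.mem_sdiff]
      constructor
      · rintro ⟨⟨_, h, _⟩, h'⟩
        exact ⟨h', h⟩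
      · rintro ⟨h', h⟩
        exact ⟨⟨polar_anti hμ.2 (ti_le_polar g ht h'), h, ht _ h'⟩, h'⟩
    · intro v
      simp only [Finset.mem_filter, Finset.mem_univ, true_and]
      exact fun h => hμ.2 h
  rw [Finset.sum_congr rfl h2, Finset.sum_const, smul_eq_mul] at h1
  rw [h1]
  refine Finset.sum_congr rfl fun v _ => ?_
  congr 1
  ext μ
  simp only [Finset.bipartiteBelow, Finset.mem_filter, Finset.mem_univ, true_and, sup_le_iff,
    Submodule.span_singleton_le_iff_mem]
  tauto

theorem ti_sup_span (g : Good q F) {W : Submodule F (Fin m → F)} (h : TotallyIsotropic q W)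
    {v : Fin m → F} (hv : v ∈ polar q W) (hvv : herm q v v = 0) :
    TotallyIsotropic q (W ⊔ Submodule.span F {v}) := by
  intro x hx
  obtain ⟨w, hw, y, hy, rfl⟩ := Submodule.mem_sup.1 hx
  obtain ⟨a, rfl⟩ := Submodule.mem_span_singleton.1 hy
  rw [add_comm, herm_expand g, hvv, mem_polar.1 hv w hw, h w hw]
  simp [zero_pow g.q0]

theorem finrank_sup_span {W : Submodule F (Fin m → F)} {v : Fin m → F} (hv : v ∉ W) :
    Module.finrank F ↥(W ⊔ Submodule.span F {v}) = Module.finrank F W + 1 := by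
  have h0 : v ≠ 0 := by rintro rfl; exact hv W.zero_mem
  have h1 := Submodule.finrank_sup_add_finrank_inf_eq W (Submodule.span F {v})
  have h2 : W ⊓ Submodule.span F {v} = ⊥ := by
    rw [Submodule.eq_bot_iff]
    rintro x ⟨hx, hx'⟩
    obtain ⟨a, rfl⟩ := Submodule.mem_span_singleton.1 hx'
    by_cases ha : a = 0
    · simp [ha]
    · exact absurd ((Submodule.smul_mem_iff _ ha).1 hx) hv
  rw [h2, finrank_span_singleton h0, finrank_bot] at h1
  omega

theorem gen_upper (g : Good q F) {n : ℕ} (j : ℕ) :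
    ∀ W : Submodule F (Fin (2*n+2) → F), TotallyIsotropic q W →
      Module.finrank F W + j = n + 1 →
      cnt (IsGenerator q n) W ≤ 2 ^ j * q ^ (j ^ 2) := by
  have h5 := g.five
  induction j with
  | zero =>
    intro W hW hd
    simp only [pow_zero, ne_eq, OfNat.ofNat_ne_zero, not_false_eq_true, zero_pow, mul_one]
    rw [cnt, Finset.card_le_one]
    have key : ∀ μ, IsGenerator q n μ ∧ W ≤ μ → W = μ := by
      rintro μ ⟨⟨h1, _⟩, h2⟩
      exact Submodule.eq_of_le_of_finrank_eq h2 (by omega)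
    intro a ha b hb
    simp only [Finset.mem_filter, Finset.mem_univ, true_and] at ha hb
    rw [← key a ha, key b hb]
  | succ j ih =>
    intro W hW hd
    obtain ⟨k, hk⟩ : ∃ k, Module.finrank F W = k := ⟨_, rfl⟩
    have hrec := gen_rec g (IsGenerator q n) (fun _ h => h) W hk
    set N := cnt (IsGenerator q n) W
    set A := Finset.univ.filter (fun v => v ∈ polar q W ∧ v ∉ W ∧ herm q v v = 0) with hA
    have hsum : N * (q ^ (2*n+2) - q ^ (2*k)) ≤ A.card * (2 ^ j * q ^ (j ^ 2)) := by
      rw [hrec]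
      refine (Finset.sum_le_card_nsmul A _ (2 ^ j * q ^ (j ^ 2)) fun v hv => ?_).trans
        (le_of_eq (smul_eq_mul _ _))
      simp only [hA, Finset.mem_filter, Finset.mem_univ, true_and] at hv
      apply ih _ (ti_sup_span g hW hv.1 hv.2.2)
      rw [finrank_sup_span hv.2.1]
      omega
    have hp := finrank_polar g W
    have hcard : A.card ≤ q ^ (2*(n+j)+3) + q ^ (2*(n+j)+2) := by
      refine le_trans (Finset.card_le_card ?_)
        (iso_bounds g (U := polar q W) (d := n + j) (by omega) ?_).2
      · intro v
        simp only [hA, Finset.mem_filter, Finset.mem_univ, true_and]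
        tauto
      · rw [polar_polar g]
        refine (Submodule.finrank_mono inf_le_right).trans ?_
        omega
    have hle : q ^ (2*k) ≤ q ^ (2*n) := Nat.pow_le_pow_right (by omega) (by omega)
    have h1 : N * (q ^ (2*n+2) - q ^ (2*n)) ≤
        (q ^ (2*(n+j)+3) + q ^ (2*(n+j)+2)) * (2 ^ j * q ^ (j ^ 2)) :=
      calc _ ≤ N * (q ^ (2*n+2) - q ^ (2*k)) := by gcongr
        _ ≤ _ := hsum
        _ ≤ _ := by gcongr
    obtain ⟨r, rfl⟩ : ∃ r, q = r + 1 := ⟨q - 1, by omega⟩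
    have h2 : (r+1) ^ (2*n+2) - (r+1) ^ (2*n) = (r+1)^(2*n) * (r * (r+2)) := by
      rw [pow_add, Nat.sub_eq_iff_eq_add]
      · ring
      · exact Nat.le_mul_of_pos_right _ (by positivity)
    rw [h2] at h1
    have h3 : ((r+1)^(2*n) * (r * (r+2))) * N ≤
        ((r+1)^(2*n) * (r * (r+2))) * (2 ^ (j+1) * (r+1) ^ ((j+1) ^ 2)) := by
      calc _ ≤ ((r+1) ^ (2*(n+j)+3) + (r+1) ^ (2*(n+j)+2)) * (2 ^ j * (r+1) ^ (j ^ 2)) := by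
            rw [mul_comm]; exact h1
        _ = ((r+1)^(2*n) * (r+1) ^ (2*j+1) * (2^j * (r+1) ^ (j^2))) * ((r+1) * (r+2)) := by ring
        _ ≤ ((r+1)^(2*n) * (r+1) ^ (2*j+1) * (2^j * (r+1) ^ (j^2))) * (2 * r * (r+2)) := by
            gcongr; omega
        _ = _ := by ring
    exact Nat.le_of_mul_le_mul_left h3 (by have : 0 < r := by omega
                                           positivity)

theorem polar_not_le (g : Good q F) {n : ℕ} {π W P : Submodule F (Fin (2*n+2) → F)}
    (hπ : Module.finrank F π = n + 1) (hW : TotallyIsotropic q W)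
    (hk : Module.finrank F W ≤ n)
    (h1 : Module.finrank F ↥(W ⊓ π) = 1) (h2 : Module.finrank F ↥(W ⊓ polar q π) = 1) :
    ¬ polar q W ≤ W ⊔ π := by
  intro h
  have h3 := polar_anti (q := q) h
  rw [polar_polar g, polar_sup g] at h3
  have h4 : polar q W ⊓ polar q π ≤ W ⊓ polar q π := le_inf h3 inf_le_right
  have h5 := Submodule.finrank_mono h4
  rw [← polar_sup g] at h5
  have h6 := finrank_polar g (W ⊔ π)
  have h7 := Submodule.finrank_sup_add_finrank_inf_eq W π
  omega

theorem inf_sup_span {W U : Submodule F (Fin m → F)} {v : Fin m → F} (hv : v ∉ W ⊔ U) :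
    (W ⊔ Submodule.span F {v}) ⊓ U = W ⊓ U := by
  apply le_antisymm
  · rintro x ⟨hx, hxU⟩
    obtain ⟨w, hw, y, hy, rfl⟩ := Submodule.mem_sup.1 hx
    obtain ⟨a, rfl⟩ := Submodule.mem_span_singleton.1 hy
    by_cases ha : a = 0
    · subst ha
      simp only [zero_smul, add_zero] at hxU ⊢
      exact ⟨hw, hxU⟩
    · exfalso
      apply hv
      rw [← Submodule.smul_mem_iff _ ha]
      have : a • v = -w + (w + a • v) := by simp
      rw [this]
      exact Submodule.add_mem _ (Submodule.mem_sup_left (W.neg_mem hw))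
        (Submodule.mem_sup_right hxU)
  · exact inf_le_inf_right _ le_sup_left

theorem card_inf_lt (g : Good q F) {U T : Submodule F (Fin m → F)} {d : ℕ}
    (hd : Module.finrank F U = d + 1) (h : ¬ U ≤ T) :
    (Finset.univ.filter fun v => v ∈ U ∧ v ∈ T).card ≤ q ^ (2 * d) := by
  have h5 := g.five
  have h1 := card_mem g (U ⊓ T)
  simp only [Submodule.mem_inf] at h1
  rw [h1]
  apply Nat.pow_le_pow_right (by omega)
  have : Module.finrank F ↥(U ⊓ T) < Module.finrank F U := by
    apply Submodule.finrank_lt_finrank_of_lt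
    refine lt_of_le_of_ne inf_le_left fun hh => h ?_
    rw [← hh]; exact inf_le_right
  omega

theorem arith_aux {T q b : ℕ} (hq : 5 ≤ q) (h : T * (q * q) ≤ T + 2 * (T * q) + b) :
    T * (q * q) ≤ 2 * b := by
  have e3 : T * (2 + 4 * q) ≤ T * (q * q) := Nat.mul_le_mul_left _ (by nlinarith)
  have e4 : T * (2 + 4 * q) = 2 * T + 4 * (T * q) := by ring
  omega

/-- generators meeting `π` exactly in `P` and its polar exactly in `R` -/
def GG (q n : ℕ) (π P R μ : Submodule F (Fin (2*n+2) → F)) : Prop :=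
  IsGenerator q n μ ∧ μ ⊓ π = P ∧ μ ⊓ polar q π = R

theorem gen_lower (g : Good q F) {n : ℕ} {π P R : Submodule F (Fin (2*n+2) → F)}
    (hπ : Module.finrank F π = n + 1) (hP : Module.finrank F P = 1)
    (hR : Module.finrank F R = 1) (j : ℕ) :
    ∀ W : Submodule F (Fin (2*n+2) → F), TotallyIsotropic q W →
      Module.finrank F W + j = n + 1 → W ⊓ π = P → W ⊓ polar q π = R →
      q ^ (j ^ 2) ≤ 2 ^ j * cnt (GG q n π P R) W := by
  have h5 := g.five
  induction j with
  | zero =>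
    intro W hW hd h1 h2
    simp only [pow_zero, ne_eq, OfNat.ofNat_ne_zero, not_false_eq_true, zero_pow, one_mul]
    rw [cnt, Nat.one_le_iff_ne_zero, ← Nat.pos_iff_ne_zero, Finset.card_pos]
    refine ⟨W, ?_⟩
    simp only [Finset.mem_filter, Finset.mem_univ, true_and]
    exact ⟨⟨⟨by omega, hW⟩, h1, h2⟩, le_rfl⟩
  | succ j ih =>
    intro W hW hd hWP hWR
    obtain ⟨k, hk⟩ : ∃ k, Module.finrank F W = k := ⟨_, rfl⟩
    have hrec := gen_rec g (GG q n π P R)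
      (fun _ h => h.1) W hk
    set N := cnt (GG q n π P R) W
    set A := Finset.univ.filter (fun v => v ∈ polar q W ∧ v ∉ W ∧ herm q v v = 0) with hA
    set B := A.filter (fun v => v ∉ W ⊔ π ∧ v ∉ W ⊔ polar q π) with hB
    have hsum : B.card * q ^ (j ^ 2) ≤ 2 ^ j * (N * q ^ (2*n+2)) := by
      calc B.card * q ^ (j ^ 2) = ∑ v ∈ B, q ^ (j ^ 2) := by simp
        _ ≤ ∑ v ∈ B, 2 ^ j * cnt (GG q n π P R) (W ⊔ Submodule.span F {v}) := by
            refine Finset.sum_le_sum fun v hv => ?_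
            simp only [hB, hA, Finset.mem_filter, Finset.mem_univ, true_and] at hv
            obtain ⟨⟨hv1, hv2, hv3⟩, hv4, hv5⟩ := hv
            refine ih _ (ti_sup_span g hW hv1 hv3) ?_ ?_ ?_
            · rw [finrank_sup_span hv2]; omega
            · rw [inf_sup_span hv4, hWP]
            · rw [inf_sup_span hv5, hWR]
        _ ≤ ∑ v ∈ A, 2 ^ j * cnt (GG q n π P R) (W ⊔ Submodule.span F {v}) :=
            Finset.sum_le_sum_of_subset (Finset.filter_subset _ _)
        _ = 2 ^ j * (N * (q ^ (2*n+2) - q ^ (2*k))) := by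
            rw [← Finset.mul_sum, ← hrec]
        _ ≤ _ := by gcongr; exact Nat.sub_le _ _
    have hp := finrank_polar g W
    have hpi := finrank_polar g π
    have hcard := (iso_bounds g (U := polar q W) (d := n + j) (by omega) (by
        rw [polar_polar g]
        refine (Submodule.finrank_mono inf_le_right).trans ?_
        omega)).1
    rw [polar_polar g, ← hA] at hcard
    have hc1 := card_inf_lt g (U := polar q W) (T := W ⊔ π) (d := n + j + 1) (by omega)
      (polar_not_le g (P := P) hπ hW (by omega) (by rw [hWP, hP]) (by rw [hWR, hR]))
    have hc2 := card_inf_lt g (U := polar q W) (T := W ⊔ polar q π) (d := n + j + 1) (by omega)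
      (polar_not_le g (P := P) (by omega) hW (by omega) (by rw [hWR, hR])
        (by rw [polar_polar g, hWP, hP]))
    have hsub : A ⊆ B ∪ ((Finset.univ.filter fun v => v ∈ polar q W ∧ v ∈ W ⊔ π) ∪
        (Finset.univ.filter fun v => v ∈ polar q W ∧ v ∈ W ⊔ polar q π)) := by
      intro v
      simp only [hB, hA, Finset.mem_union, Finset.mem_filter, Finset.mem_univ, true_and]
      tauto
    have hc3 := ((Finset.card_le_card hsub).trans (Finset.card_union_le _ _)).trans
      (Nat.add_le_add_left (Finset.card_union_le _ _) _)
    have hc4 : q ^ (2*(n+j)+3) ≤ q ^ (2*(n+j)+1) + 2 * q ^ (2*(n+j)+2) + B.card := by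
      have e : 2 * (n + j + 1) = 2*(n+j)+2 := by ring
      rw [e] at hc1 hc2
      omega
    have hc5 : q ^ (2*(n+j)+3) ≤ 2 * B.card := by
      have e1 : q ^ (2*(n+j)+3) = q ^ (2*(n+j)+1) * (q * q) := by ring
      have e2 : q ^ (2*(n+j)+2) = q ^ (2*(n+j)+1) * q := by ring
      rw [e1] at hc4 ⊢
      rw [e2] at hc4
      exact arith_aux h5 hc4
    have h3 : q ^ (2*n+2) * q ^ ((j+1) ^ 2) ≤ q ^ (2*n+2) * (2 ^ (j+1) * N) := by
      calc q ^ (2*n+2) * q ^ ((j+1) ^ 2) = q ^ (2*(n+j)+3) * q ^ (j ^ 2) := by ring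
        _ ≤ (2 * B.card) * q ^ (j ^ 2) := by gcongr
        _ = 2 * (B.card * q ^ (j ^ 2)) := by ring
        _ ≤ 2 * (2 ^ j * (N * q ^ (2*n+2))) := by gcongr
        _ = _ := by ring
    exact Nat.le_of_mul_le_mul_left h3 (by positivity)

theorem card_pts (g : Good q F) (T : Finset (Submodule F (Fin m → F)))
    (hT : ∀ P ∈ T, Module.finrank F P = 1) :
    (Finset.univ.filter fun v : Fin m → F => v ≠ 0 ∧ Submodule.span F {v} ∈ T).card
      = T.card * (q ^ 2 - 1) := by
  rw [Finset.card_eq_sum_card_fiberwise (t := T) (f := fun v => Submodule.span F {v})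
    (by intro v hv; simp only [Finset.coe_filter, Finset.mem_univ, true_and,
          Set.mem_ofPred_eq] at hv; exact hv.2)]
  rw [← smul_eq_mul, ← Finset.sum_const]
  refine Finset.sum_congr rfl fun P hP => ?_
  have h1 := card_mem g P
  rw [hT P hP, mul_one] at h1
  rw [← h1, ← Finset.card_erase_of_mem (a := 0) (by simp)]
  congr 1
  ext v
  simp only [Finset.mem_filter, Finset.mem_univ, true_and, Finset.mem_erase]
  constructor
  · rintro ⟨⟨h0, h2⟩, rfl⟩
    exact ⟨h0, Submodule.mem_span_singleton_self v⟩
  · rintro ⟨h1, h2⟩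
    have : Submodule.span F {v} = P := by
      apply Submodule.eq_of_le_of_finrank_eq
      · simpa using h2
      · rw [finrank_span_singleton h1, hT P hP]
    exact ⟨⟨h1, this ▸ hP⟩, this⟩

theorem pos_aux (g : Good q F) : 0 < q ^ 2 - 1 := by
  have := g.five
  have : 1 < q ^ 2 := by nlinarith
  omega

/-- points of the variety in `π` outside the radical -/
noncomputable def XX (q : ℕ) (π : Submodule F (Fin m → F)) : Finset (Submodule F (Fin m → F)) :=
  Finset.univ.filter fun P => IsHermPoint q P ∧ P ≤ π ∧ ¬ P ≤ π ⊓ polar q π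

theorem card_XX (g : Good q F) {n r : ℕ} (hr : n = r + 1) {π : Submodule F (Fin (2*n+2) → F)}
    (hπ : Module.finrank F π = n + 1) (hi : Module.finrank F ↥(π ⊓ polar q π) ≤ r) :
    q ^ (2 * r + 1) ≤ (XX q π).card := by
  have h1 := (iso_bounds g (U := π) (d := r) (by omega) hi).1
  have h2 := card_pts g (XX q π) (fun P hP => (Finset.mem_filter.1 hP).2.1.1)
  have h3 : (Finset.univ.filter fun v => v ∈ π ∧ v ∉ polar q π ∧ herm q v v = 0).card ≤
      (XX q π).card * (q ^ 2 - 1) := by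
    rw [← h2]
    apply Finset.card_le_card
    intro v hv
    simp only [Finset.mem_filter, Finset.mem_univ, true_and] at hv ⊢
    obtain ⟨h1, h2, h3⟩ := hv
    have h0 : v ≠ 0 := by rintro rfl; exact h2 (Submodule.zero_mem _)
    refine ⟨h0, ?_⟩
    simp only [XX, Finset.mem_filter, Finset.mem_univ, true_and, le_inf_iff,
      Submodule.span_singleton_le_iff_mem, not_and]
    refine ⟨⟨finrank_span_singleton h0, ?_⟩, h1, fun _ => h2⟩
    intro x hx
    obtain ⟨a, rfl⟩ := Submodule.mem_span_singleton.1 hx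
    rw [herm_smul_left, herm_smul_right g, h3]; simp
  have hp := pos_aux g
  have h4 : q ^ (2 * r + 1) * (q ^ 2 - 1) ≤ (XX q π).card * (q ^ 2 - 1) := by
    rw [Nat.mul_sub, mul_one]
    have : q ^ (2 * r + 1) * q ^ 2 = q ^ (2 * r + 3) := by ring
    omega
  exact Nat.le_of_mul_le_mul_right h4 hp

theorem sup_inf_of_mem {π P R : Submodule F (Fin m → F)} (hP : P ≤ π) (hR : Module.finrank F R = 1)
    (hRπ : ¬ R ≤ π) : (P ⊔ R) ⊓ π = P := by
  apply le_antisymm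
  · rintro x ⟨hx, hxπ⟩
    obtain ⟨a, ha, b, hb, rfl⟩ := Submodule.mem_sup.1 hx
    have hbπ : b ∈ π := by
      have := π.sub_mem hxπ (hP ha)
      simpa using this
    have hb0 : b = 0 := by
      by_contra h0
      apply hRπ
      have : Submodule.span F {b} = R := by
        apply Submodule.eq_of_le_of_finrank_eq
        · simpa using hb
        · rw [finrank_span_singleton h0, hR]
      rw [← this]; simpa using hbπ
    subst hb0
    simpa using ha
  · exact le_inf le_sup_left hP

theorem eq_of_le_point {P Q : Submodule F (Fin m → F)} (hP : Module.finrank F P = 1)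
    (hQ : Module.finrank F Q = 1) (h : Q ≤ P) : Q = P :=
  Submodule.eq_of_le_of_finrank_eq h (by omega)

theorem finrank_sup_pt {P Q : Submodule F (Fin m → F)} (hP : Module.finrank F P = 1)
    (hQ : Module.finrank F Q = 1) (h : ¬ Q ≤ P) : Module.finrank F ↥(Q ⊔ P) = 2 := by
  have h1 := Submodule.finrank_sup_add_finrank_inf_eq Q P
  have h2 : Module.finrank F ↥(Q ⊓ P) < 1 := by
    rw [← hQ]
    apply Submodule.finrank_lt_finrank_of_lt
    exact inf_lt_left.2 h
  omega

theorem exists_other {p n : ℕ} (g : Good q F) {c : Submodule F (Fin (2*n+2) → F) → ZMod p}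
    (hc : IsCodeword p q n c) {π μ P R : Submodule F (Fin (2*n+2) → F)} (hμ : IsGenerator q n μ)
    (hP : μ ⊓ π = P) (hR : μ ⊓ polar q π = R)
    (hP1 : Module.finrank F P = 1) (hR1 : Module.finrank F R = 1)
    (h : (c P ≠ 0 ∧ c R = 0) ∨ (c P = 0 ∧ c R ≠ 0)) :
    ∃ Q, c Q ≠ 0 ∧ Q ≤ μ ∧ ¬ Q ≤ π ∧ ¬ Q ≤ polar q π := by
  by_contra! hcon
  have hpt : ∀ Q, c Q ≠ 0 → IsHermPoint q Q := fun Q hQ => by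
    by_contra hh; exact hQ (hc.1 Q hh)
  have hsum := hc.2 μ hμ
  have hPR : ∀ Q, c Q ≠ 0 → Q ≤ μ → Q = P ∨ Q = R := by
    intro Q h1 h2
    by_cases h3 : Q ≤ π
    · exact Or.inl (eq_of_le_point hP1 (hpt Q h1).1 (hP ▸ le_inf h2 h3))
    · exact Or.inr (eq_of_le_point hR1 (hpt Q h1).1 (hR ▸ le_inf h2 (hcon Q h1 h2 h3)))
  have hPμ : P ≤ μ := hP ▸ inf_le_left
  have hRμ : R ≤ μ := hR ▸ inf_le_left
  rcases h with ⟨h1, h2⟩ | ⟨h1, h2⟩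
  · rw [finsum_mem_eq_sum_of_inter_support_eq c (t := {P}), Finset.sum_singleton] at hsum
    · exact h1 hsum
    · ext Q
      simp only [Set.mem_inter_iff, Set.mem_ofPred_eq, Function.mem_support,
        Finset.coe_singleton, Set.mem_singleton_iff]
      constructor
      · rintro ⟨⟨_, h4⟩, h5⟩
        rcases hPR Q h5 h4 with h6 | h6
        · exact ⟨h6, h5⟩
        · rw [h6] at h5; exact absurd h2 h5
      · rintro ⟨rfl, h5⟩
        exact ⟨⟨hpt _ h5, hPμ⟩, h5⟩
  · rw [finsum_mem_eq_sum_of_inter_support_eq c (t := {R}), Finset.sum_singleton] at hsum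
    · exact h2 hsum
    · ext Q
      simp only [Set.mem_inter_iff, Set.mem_ofPred_eq, Function.mem_support,
        Finset.coe_singleton, Set.mem_singleton_iff]
      constructor
      · rintro ⟨⟨_, h4⟩, h5⟩
        rcases hPR Q h5 h4 with h6 | h6
        · rw [h6] at h5; exact absurd h1 h5
        · exact ⟨h6, h5⟩
      · rintro ⟨rfl, h5⟩
        exact ⟨⟨hpt _ h5, hRμ⟩, h5⟩

/-- generators through a point `Q` off `π` and its polar -/
theorem bad_Q (g : Good q F) {n r : ℕ} (hr : n = r + 1) {π Q : Submodule F (Fin (2*n+2) → F)}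
    (hπ : Module.finrank F π = n + 1) (hQ : Module.finrank F Q = 1) (hQπ : ¬ Q ≤ π)
    (hQp : ¬ Q ≤ polar q π) :
    (Finset.univ.filter fun μ => IsGenerator q n μ ∧ Module.finrank F ↥(μ ⊓ π) = 1 ∧ Q ≤ μ).card
      ≤ (2 * q ^ (2 * r)) * (2 ^ r * q ^ (r ^ 2)) := by
  have h5 := g.five
  set T : Finset (Submodule F (Fin (2*n+2) → F)) := Finset.univ.filter fun P =>
    Module.finrank F P = 1 ∧ P ≤ π ∧ P ≤ polar q Q ∧ TotallyIsotropic q (Q ⊔ P) with hT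
  have hTc : T.card ≤ 2 * q ^ (2 * r) := by
    have h1 := card_pts g T (fun P hP => (Finset.mem_filter.1 hP).2.1)
    have h2 := card_inf_lt g (U := π) (T := polar q Q) (d := n) hπ (by
      intro h
      apply hQp
      have := polar_anti (q := q) h
      rwa [polar_polar g] at this)
    have h3 : T.card * (q ^ 2 - 1) ≤ q ^ (2 * n) := by
      rw [← h1]
      refine le_trans (Finset.card_le_card ?_) h2
      intro v
      simp only [hT, Finset.mem_filter, Finset.mem_univ, true_and,
        Submodule.span_singleton_le_iff_mem]
      tauto
    have h4 : T.card * (q ^ 2 - 1) ≤ (2 * q ^ (2 * r)) * (q ^ 2 - 1) := by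
      refine h3.trans ?_
      have e : q ^ (2 * n) = q ^ (2 * r) * q ^ 2 := by rw [hr]; ring
      rw [e, mul_comm 2 (q ^ (2 * r)), mul_assoc]
      gcongr
      have : 2 ≤ q ^ 2 := by nlinarith
      omega
    exact Nat.le_of_mul_le_mul_right h4 (pos_aux g)
  have hsub : (Finset.univ.filter fun μ => IsGenerator q n μ ∧
      Module.finrank F ↥(μ ⊓ π) = 1 ∧ Q ≤ μ) ⊆
      T.biUnion (fun P => Finset.univ.filter fun μ => IsGenerator q n μ ∧ Q ⊔ P ≤ μ) := by
    intro μ hμ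
    simp only [hT, Finset.mem_biUnion, Finset.mem_filter, Finset.mem_univ, true_and] at hμ ⊢
    obtain ⟨h1, h2, h3⟩ := hμ
    have hle : Q ⊔ μ ⊓ π ≤ μ := sup_le h3 inf_le_left
    exact ⟨μ ⊓ π, ⟨h2, inf_le_right, inf_le_left.trans ((ti_le_polar g h1.2).trans (polar_anti h3)),
      fun x hx => h1.2 x (hle hx)⟩, h1, hle⟩
  refine (Finset.card_le_card hsub).trans (Finset.card_biUnion_le.trans ?_)
  refine (Finset.sum_le_card_nsmul T _ (2 ^ r * q ^ (r ^ 2)) fun P hP => ?_).trans ?_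
  · simp only [hT, Finset.mem_filter, Finset.mem_univ, true_and] at hP
    have := gen_upper g r (Q ⊔ P) hP.2.2.2 (by
      rw [finrank_sup_pt hP.1 hQ (fun h => hQπ (h.trans hP.2.1))]; omega)
    exact this
  · rw [smul_eq_mul]
    gcongr

theorem key (g : Good q F) {p n r : ℕ} (hr : n = r + 1) {π : Submodule F (Fin (2*n+2) → F)}
    (hπ : Module.finrank F π = n + 1) {c : Submodule F (Fin (2*n+2) → F) → ZMod p}
    (hc : IsCodeword p q n c) (hn : 2 ≤ n) :
    ((XX q π).filter fun P => c P ≠ 0).card * ((XX q (polar q π)).filter fun P => c P = 0).card +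
    ((XX q π).filter fun P => c P = 0).card * ((XX q (polar q π)).filter fun P => c P ≠ 0).card
    ≤ 2 * 4 ^ r * (wt c * q ^ (2 * r)) := by
  have h5 := g.five
  set D := (((XX q π).filter fun P => c P ≠ 0) ×ˢ ((XX q (polar q π)).filter fun P => c P = 0)) ∪
    (((XX q π).filter fun P => c P = 0) ×ˢ ((XX q (polar q π)).filter fun P => c P ≠ 0)) with hD
  have hDcard : D.card = ((XX q π).filter fun P => c P ≠ 0).card *
      ((XX q (polar q π)).filter fun P => c P = 0).card +
    ((XX q π).filter fun P => c P = 0).card *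
      ((XX q (polar q π)).filter fun P => c P ≠ 0).card := by
    rw [hD, Finset.card_union_of_disjoint, Finset.card_product, Finset.card_product]
    rw [Finset.disjoint_left]
    rintro ⟨P, R⟩ h1 h2
    simp only [Finset.mem_product, Finset.mem_filter] at h1 h2
    exact h1.1.2 h2.1.2
  rw [← hDcard]
  have hDmem : ∀ P R, (P, R) ∈ D → P ∈ XX q π ∧ R ∈ XX q (polar q π) ∧
      ((c P ≠ 0 ∧ c R = 0) ∨ (c P = 0 ∧ c R ≠ 0)) := by
    intro P R h
    simp only [hD, Finset.mem_union, Finset.mem_product, Finset.mem_filter] at h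
    tauto
  set Bad := Finset.univ.filter fun μ => IsGenerator q n μ ∧ (μ ⊓ π, μ ⊓ polar q π) ∈ D with hBad
  -- lower bound
  have hlow : D.card * q ^ (r ^ 2) ≤ 2 ^ r * Bad.card := by
    rw [Finset.card_eq_sum_card_fiberwise (s := Bad) (t := D)
      (f := fun μ => (μ ⊓ π, μ ⊓ polar q π))
      (by intro μ hμ; exact (Finset.mem_filter.1 hμ).2.2), Finset.mul_sum]
    refine (le_of_eq (smul_eq_mul _ _).symm).trans (Finset.card_nsmul_le_sum _ _ _ ?_)
    rintro ⟨P, R⟩ hPR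
    obtain ⟨hP, hR, _⟩ := hDmem P R hPR
    simp only [XX, Finset.mem_filter, Finset.mem_univ, true_and, le_inf_iff, not_and,
      polar_polar g] at hP hR
    obtain ⟨⟨hP1, hP2⟩, hP3, hP4⟩ := hP
    obtain ⟨⟨hR1, hR2⟩, hR3, hR4⟩ := hR
    have hPp := hP4 hP3
    have hRp := hR4 hR3
    have hti : TotallyIsotropic q (P ⊔ R) := by
      intro x hx
      obtain ⟨a, ha, b, hb, rfl⟩ := Submodule.mem_sup.1 hx
      have hba : herm q b a = 0 := mem_polar.1 (hR3 hb) a (hP3 ha)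
      rw [herm_add_left, herm_add_right g, herm_add_right g, hP2 a ha, hR2 b hb, hba,
        herm_zero_swap g hba]
      simp
    have := gen_lower g hπ hP1 hR1 r (P ⊔ R) hti
      (by rw [finrank_sup_pt hR1 hP1 (fun h => hPp (h.trans hR3))]; omega)
      (sup_inf_of_mem hP3 hR1 hRp) (by rw [sup_comm]; exact sup_inf_of_mem hR3 hP1 hPp)
    refine this.trans (Nat.mul_le_mul_left _ (Finset.card_le_card ?_))
    intro μ hμ
    obtain ⟨_, ⟨h1, h2, h3⟩, h4⟩ := Finset.mem_filter.1 hμ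
    simp only [hBad, Finset.mem_filter, Finset.mem_univ, true_and]
    rw [h2, h3]
    exact ⟨⟨h1, hPR⟩, rfl⟩
  -- upper bound
  set S := Finset.univ.filter fun Q => c Q ≠ 0 ∧ ¬ Q ≤ π ∧ ¬ Q ≤ polar q π with hS
  have hSc : S.card ≤ wt c := by
    rw [wt, Nat.card_eq_fintype_card, Fintype.card_subtype]
    apply Finset.card_le_card
    intro Q
    simp only [hS, Finset.mem_filter, Finset.mem_univ, true_and]
    tauto
  have hup : Bad.card ≤ wt c * ((2 * q ^ (2 * r)) * (2 ^ r * q ^ (r ^ 2))) := by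
    have hsub : Bad ⊆ S.biUnion (fun Q => Finset.univ.filter fun μ => IsGenerator q n μ ∧
        Module.finrank F ↥(μ ⊓ π) = 1 ∧ Q ≤ μ) := by
      intro μ hμ
      simp only [hBad, hS, Finset.mem_biUnion, Finset.mem_filter, Finset.mem_univ,
        true_and] at hμ ⊢
      obtain ⟨h1, h2⟩ := hμ
      obtain ⟨hP, hR, h3⟩ := hDmem _ _ h2
      have hP1 := (Finset.mem_filter.1 hP).2.1.1
      have hR1 := (Finset.mem_filter.1 hR).2.1.1
      obtain ⟨Q, hQ1, hQ2, hQ3⟩ := exists_other g hc h1 rfl rfl hP1 hR1 h3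
      exact ⟨Q, ⟨hQ1, hQ3⟩, h1, hP1, hQ2⟩
    refine (Finset.card_le_card hsub).trans (Finset.card_biUnion_le.trans ?_)
    refine (Finset.sum_le_card_nsmul S _ ((2 * q ^ (2 * r)) * (2 ^ r * q ^ (r ^ 2)))
      fun Q hQ => ?_).trans ?_
    · simp only [hS, Finset.mem_filter, Finset.mem_univ, true_and] at hQ
      refine bad_Q g hr hπ ?_ hQ.2.1 hQ.2.2
      by_contra hh
      exact hQ.1 (hc.1 Q (fun h => hh h.1))
    · rw [smul_eq_mul]
      gcongr
  have hfin : D.card * q ^ (r ^ 2) ≤ (2 * 4 ^ r * (wt c * q ^ (2 * r))) * q ^ (r ^ 2) := by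
    calc _ ≤ 2 ^ r * Bad.card := hlow
      _ ≤ 2 ^ r * (wt c * ((2 * q ^ (2 * r)) * (2 ^ r * q ^ (r ^ 2)))) := by gcongr
      _ = _ := by
        have : (4:ℕ) ^ r = 2 ^ r * 2 ^ r := by rw [← mul_pow]; norm_num
        rw [this]; ring
  exact Nat.le_of_mul_le_mul_right hfin (by positivity)


end Counting

section Final

theorem good_of (p hh q : ℕ) (hp : p.Prime) (hq : q = p ^ hh) (h5 : 5 ≤ q) (F : Type) [Field F]
    [Fintype F] (hF : Fintype.card F = q ^ 2) : Good q F := by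
  refine ⟨hF, ?_, h5⟩
  obtain ⟨r, hr⟩ := CharP.exists F
  obtain ⟨k, hrp, hk⟩ := FiniteField.card F r
  have hrp' : r ∣ p := by
    have h1 : r ∣ (p ^ hh) ^ 2 := by
      rw [← hq, ← hF, hk]
      exact dvd_pow_self r k.pos.ne'
    exact hrp.dvd_of_dvd_pow (hrp.dvd_of_dvd_pow h1)
  have : r = p := (Nat.prime_dvd_prime_iff_eq hrp hp).1 hrp'
  subst this
  haveI : Fact r.Prime := ⟨hrp⟩
  intro x y
  rw [hq]
  exact add_pow_char_pow x y r hh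

theorem mu_bound {q : ℕ} (hq : 5 ≤ q) (s : ℕ) :
    muH q ((s:ℤ) + 1) ≤ (q:ℚ) ^ (2*s+1) + 4 * (q:ℚ) ^ (2*s) := by
  have hq' : (5:ℚ) ≤ q := by exact_mod_cast hq
  have e1 : ((s:ℤ) + 1 + 1) = ((s+2 : ℕ) : ℤ) := by push_cast; ring
  have e2 : ((s:ℤ) + 1) = ((s+1 : ℕ) : ℤ) := by push_cast; ring
  rw [muH, e1, e2, zpow_natCast, zpow_natCast, zpow_natCast, zpow_natCast]
  have hpos : (0:ℚ) < (q:ℚ)^2 - 1 := by nlinarith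
  rw [div_le_iff₀ hpos]
  have h1 : (1:ℚ) ≤ (q:ℚ)^s := one_le_pow₀ (by linarith)
  set T := (q:ℚ)^s with hT
  have a1 : (q:ℚ)^(s+2) = T * q^2 := by rw [pow_add]
  have a2 : (q:ℚ)^(s+1) = T * q := by rw [pow_succ]
  have a3 : (q:ℚ)^(2*s+1) = T^2 * q := by rw [hT]; ring
  have a4 : (q:ℚ)^(2*s) = T^2 := by rw [hT]; ring
  rw [a1, a2, a3, a4]
  have b1 : (T * (q:ℚ)^2 - (-1)^(s+2)) * (T * q - (-1)^(s+1))
      ≤ (T * (q:ℚ)^2 + 1) * (T * q + 1) := by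
    have hTq : 0 ≤ T * (q:ℚ) := by positivity
    have hTq2 : 0 ≤ T * (q:ℚ)^2 := by positivity
    rcases neg_one_pow_eq_or ℚ s with h | h
    · simp only [pow_add, h]; nlinarith
    · simp only [pow_add, h]; nlinarith
  refine b1.trans ?_
  have hTT : T ≤ T^2 := by nlinarith
  have c1 : T * (q:ℚ)^2 ≤ T^2 * (q:ℚ)^2 := by gcongr
  have c2 : T * (q:ℚ) ≤ T^2 * (q:ℚ) := by gcongr
  have c3 : (1:ℚ) ≤ T^2 := by nlinarith
  have c4 : T^2 * 5 ≤ T^2 * (q:ℚ) := by gcongr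
  have c5 : T^2 * (q:ℚ) * 5 ≤ T^2 * (q:ℚ) * q := by gcongr
  nlinarith

theorem mu_bound2 {q : ℕ} (hq : 5 ≤ q) (s : ℕ) :
    muH q ((s:ℤ) + 1) ≤ 2 * (q:ℚ) ^ (2*s+1) := by
  have hq' : (5:ℚ) ≤ q := by exact_mod_cast hq
  have := mu_bound hq s
  have h : (4:ℚ) * (q:ℚ) ^ (2*s) ≤ q * (q:ℚ) ^ (2*s) := by gcongr; linarith
  rw [pow_succ] at this ⊢
  linarith

theorem sigma_odd {q : ℕ} (hq : 5 ≤ q) (b j n : ℕ) (i : ℤ) (hn : n = b + j + 2)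
    (hi : i = (j:ℤ) - 1) (ho : Odd ((n:ℤ) - i)) :
    SigmaNI q n i ≤ 2 * (q:ℚ)^(2*n-1) + 28 * (q:ℚ)^(2*n-2) := by
  have hq' : (5:ℚ) ≤ q := by exact_mod_cast hq
  have hq0 : (q:ℚ) ≠ 0 := by linarith
  rw [SigmaNI, if_pos ho]
  have e1 : 2*i+2 = ((2*j : ℕ) : ℤ) := by subst hi; push_cast; ring
  have e2 : (n:ℤ)-i-1 = ((b+1 : ℕ) : ℤ) + 1 := by subst hi hn; push_cast; ring
  have e3 : (n:ℤ)-i-2 = (b : ℤ) + 1 := by subst hi hn; push_cast; ring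
  have e4 : (n:ℤ)-3*i-5 = (b:ℤ) - ((2*j:ℕ):ℤ) := by subst hi hn; push_cast; ring
  have e5 : (q:ℚ)^(((b+1 : ℕ) : ℤ) + 1) = (q:ℚ)^(b+2) := by
    rw [show ((b+1 : ℕ) : ℤ) + 1 = ((b+2:ℕ):ℤ) by push_cast; ring, zpow_natCast]
  rw [e1, e2, e3, e4, e5, zpow_sub₀ hq0, zpow_natCast, zpow_natCast]
  have m1 := mu_bound hq (b+1)
  have m2 := mu_bound2 hq b
  have hpos : (0:ℚ) < (q:ℚ)^2 - 1 := by nlinarith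
  have hB : (0:ℚ) < (q:ℚ)^b := by positivity
  have hJ : (0:ℚ) < (q:ℚ)^(2*j) := by positivity
  have t1 : 4 * muH q ((b:ℤ)+1) * ((q:ℚ)^(b+2) - 1) / ((q:ℚ)^b / (q:ℚ)^(2*j) * ((q:ℚ)^2 - 1))
      ≤ 16 * (q:ℚ)^(2*b+1) * (q:ℚ)^(2*j) := by
    rw [div_le_iff₀ (by positivity)]
    have hf : (q:ℚ)^(b+2) - 1 ≤ 2 * ((q:ℚ)^b * ((q:ℚ)^2 - 1)) := by
      have h25 : (q:ℚ)^b * 25 ≤ (q:ℚ)^b * (q:ℚ)^2 := by gcongr; nlinarith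
      rw [pow_add]; nlinarith
    have hf0 : 0 ≤ (q:ℚ)^(b+2) - 1 := sub_nonneg.2 (one_le_pow₀ (by linarith))
    calc 4 * muH q ((b:ℤ)+1) * ((q:ℚ)^(b+2) - 1)
        ≤ 4 * (2 * (q:ℚ) ^ (2*b+1)) * ((q:ℚ)^(b+2) - 1) := by gcongr
      _ ≤ 4 * (2 * (q:ℚ) ^ (2*b+1)) * (2 * ((q:ℚ)^b * ((q:ℚ)^2 - 1))) := by gcongr
      _ = _ := by field_simp; ring
  have t2 : 2 * (q:ℚ)^(2*j) * muH q (((b+1 : ℕ) : ℤ) + 1) ≤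
      2 * (q:ℚ)^(2*j) * ((q:ℚ) ^ (2*(b+1)+1) + 4 * (q:ℚ) ^ (2*(b+1))) := by gcongr
  have f1 : 2*n-1 = 2*j + (2*b+1) + 2 := by omega
  have f2 : 2*n-2 = 2*j + (2*b+1) + 1 := by omega
  rw [f1, f2]
  have g1 : 2 * (q:ℚ)^(2*j) * ((q:ℚ) ^ (2*(b+1)+1) + 4 * (q:ℚ) ^ (2*(b+1))) =
    2 * (q:ℚ)^(2*j + (2*b+1) + 2) + 8 * (q:ℚ)^(2*j + (2*b+1) + 1) := by ring
  have g2 : 16 * (q:ℚ)^(2*b+1) * (q:ℚ)^(2*j) ≤ 16 * (q:ℚ)^(2*j + (2*b+1) + 1) := by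
    have : 16 * (q:ℚ)^(2*b+1) * (q:ℚ)^(2*j) = 16 * (q:ℚ)^(2*j + (2*b+1)) := by ring
    rw [this]
    exact mul_le_mul_of_nonneg_left (pow_le_pow_right₀ (by linarith) (by omega)) (by norm_num)
  have g3 : 0 ≤ (q:ℚ)^(2*j + (2*b+1) + 1) := by positivity
  linarith

theorem sigma_two {q : ℕ} (hq : 5 ≤ q) (j n : ℕ) (i : ℤ) (hn : n = j + 1)
    (hi : i = (j:ℤ) - 1) (ho : ¬ Odd ((n:ℤ) - i)) :
    SigmaNI q n i ≤ 2 * (q:ℚ)^(2*n-1) + 28 * (q:ℚ)^(2*n-2) := by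
  have hq' : (5:ℚ) ≤ q := by exact_mod_cast hq
  rw [SigmaNI, if_neg ho]
  have e1 : 2*i+2 = ((2*j : ℕ) : ℤ) := by subst hi; push_cast; ring
  have e2 : (n:ℤ)-i-1 = ((0 : ℕ) : ℤ) + 1 := by subst hi hn; push_cast; ring
  have e3 : (n:ℤ)-i-3 = -1 := by subst hi hn; push_cast; ring
  have e4 : muH q (-1) = 0 := by simp [muH]
  have hpos : (0:ℚ) < (q:ℚ)^2 - 1 := by nlinarith
  have e5 : 2*((q:ℚ)^(4:ℤ) * 0 + (q:ℚ)^2 - 1)/((q:ℚ)^2 - 1) = 2 := by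
    field_simp; ring
  rw [e1, e2, e3, e4, e5, zpow_natCast]
  have m1 := mu_bound hq 0
  have f1 : 2*n-1 = 2*j + 1 := by omega
  have f2 : 2*n-2 = 2*j := by omega
  rw [f1, f2, pow_succ]
  have hJ : (0:ℚ) < (q:ℚ)^(2*j) := by positivity
  simp only [mul_zero, zero_add, pow_one, pow_zero] at m1
  have : 2 * (q:ℚ)^(2*j) * (muH q (((0:ℕ):ℤ) + 1) + 2) ≤ 2 * (q:ℚ)^(2*j) * (q + 4 * 1 + 2) := by
    gcongr
  nlinarith

theorem sigma_even {q : ℕ} (hq : 5 ≤ q) (b j n : ℕ) (i : ℤ) (hn : n = b + j + 3)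
    (hi : i = (j:ℤ) - 1) (ho : ¬ Odd ((n:ℤ) - i)) :
    SigmaNI q n i ≤ 2 * (q:ℚ)^(2*n-1) + 28 * (q:ℚ)^(2*n-2) := by
  have hq' : (5:ℚ) ≤ q := by exact_mod_cast hq
  rw [SigmaNI, if_neg ho]
  have e1 : 2*i+2 = ((2*j : ℕ) : ℤ) := by subst hi; push_cast; ring
  have e2 : (n:ℤ)-i-1 = ((b+2 : ℕ) : ℤ) + 1 := by subst hi hn; push_cast; ring
  have e3 : (n:ℤ)-i-3 = (b:ℤ) + 1 := by subst hi hn; push_cast; ring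
  have hpos : (0:ℚ) < (q:ℚ)^2 - 1 := by nlinarith
  have m1 := mu_bound hq (b+2)
  have m2 := mu_bound2 hq b
  have hB1 : (1:ℚ) ≤ (q:ℚ)^(2*b+3) := one_le_pow₀ (by linarith)
  have hJ : (0:ℚ) < (q:ℚ)^(2*j) := by positivity
  rw [e1, e2, e3, zpow_natCast, show (q:ℚ)^(4:ℤ) = (q:ℚ)^4 from by norm_cast]
  have t1 : 2*((q:ℚ)^4 * muH q ((b:ℤ)+1) + (q:ℚ)^2 - 1)/((q:ℚ)^2 - 1) ≤ 10 * (q:ℚ)^(2*b+3) := by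
    rw [div_le_iff₀ hpos]
    have h1 : (q:ℚ)^4 * muH q ((b:ℤ)+1) ≤ (q:ℚ)^4 * (2 * (q:ℚ) ^ (2*b+1)) := by gcongr
    have h2 : (q:ℚ)^4 * (2 * (q:ℚ) ^ (2*b+1)) = 2 * ((q:ℚ)^(2*b+3) * (q:ℚ)^2) := by ring
    have h3 : 1 * ((q:ℚ)^2 - 1) ≤ (q:ℚ)^(2*b+3) * ((q:ℚ)^2 - 1) := by gcongr
    have h4 : (q:ℚ)^(2*b+3) * 25 ≤ (q:ℚ)^(2*b+3) * (q:ℚ)^2 := by gcongr; nlinarith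
    nlinarith
  have t2 : 2 * (q:ℚ)^(2*j) * (muH q (((b+2 : ℕ) : ℤ) + 1) +
      2*((q:ℚ)^4 * muH q ((b:ℤ)+1) + (q:ℚ)^2 - 1)/((q:ℚ)^2 - 1)) ≤
      2 * (q:ℚ)^(2*j) * ((q:ℚ) ^ (2*(b+2)+1) + 4 * (q:ℚ) ^ (2*(b+2)) + 10 * (q:ℚ)^(2*b+3)) := by
    gcongr
  refine t2.trans ?_
  have f1 : 2*n-1 = 2*j + (2*b+3) + 2 := by omega
  have f2 : 2*n-2 = 2*j + (2*b+3) + 1 := by omega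
  rw [f1, f2]
  have g1 : 2 * (q:ℚ)^(2*j) * ((q:ℚ) ^ (2*(b+2)+1) + 4 * (q:ℚ) ^ (2*(b+2)) + 10 * (q:ℚ)^(2*b+3)) =
    2 * (q:ℚ)^(2*j + (2*b+3) + 2) + 8 * (q:ℚ)^(2*j + (2*b+3) + 1)
      + 20 * (q:ℚ)^(2*j + (2*b+3)) := by ring
  have g2 : (q:ℚ)^(2*j + (2*b+3)) ≤ (q:ℚ)^(2*j + (2*b+3) + 1) := by
    exact pow_le_pow_right₀ (by linarith) (by omega)
  rw [g1]
  linarith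

theorem sigma_le {q : ℕ} (hq : 5 ≤ q) (n : ℕ) (i : ℤ) (h1 : -1 ≤ i) (h2 : i ≤ (n:ℤ) - 2) :
    SigmaNI q n i ≤ 2 * (q:ℚ)^(2*n-1) + 28 * (q:ℚ)^(2*n-2) := by
  obtain ⟨j, hj⟩ : ∃ j : ℕ, i = (j:ℤ) - 1 := ⟨(i+1).toNat, by omega⟩
  by_cases ho : Odd ((n:ℤ) - i)
  · have : (n:ℤ) - i ≠ 2 := by
      intro h; rw [h] at ho; exact absurd ho (by decide)
    exact sigma_odd hq (n - j - 2) j n i (by omega) hj ho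
  · by_cases h3 : n = j + 1
    · exact sigma_two hq j n i h3 hj ho
    · have : (n:ℤ) - i ≠ 3 := by
        intro h; rw [h] at ho; exact absurd (by decide) ho
      exact sigma_even hq (n - j - 3) j n i (by omega) hj ho

theorem dichotomy {x t x0 t0 A η ε : ℝ} (hx : 0 ≤ x) (ht : 0 ≤ t) (hx0 : 0 ≤ x0) (ht0 : 0 ≤ t0)
    (hA : 0 < A) (hε : 0 < ε) (hε2 : ε ≤ 1 / 2) (hη : η ≤ ε ^ 2)
    (hM : A ≤ x + x0) (hM' : A ≤ t + t0) (h : x * t0 + x0 * t ≤ η * A ^ 2) :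
    x + t ≤ 2 * ε * A ∨ 2 * A - 2 * ε * A ≤ x + t := by
  have h1 : x * t0 + x0 * t ≤ (ε * A) * (ε * A) := by nlinarith [sq_nonneg A]
  have hεA : 0 < ε * A := by positivity
  have hx0t : 0 ≤ x0 * t := by positivity
  have hxt0 : 0 ≤ x * t0 := by positivity
  have hhalf : ε * A ≤ A / 2 := by nlinarith
  rcases le_or_gt x (ε * A) with hc | hc
  · left
    have h2 : A / 2 ≤ x0 := by linarith
    have h3 : (ε * A) * t ≤ (ε * A) * (ε * A) := by nlinarith
    have := le_of_mul_le_mul_left h3 hεA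
    linarith
  · right
    have h3 : (ε * A) * t0 ≤ (ε * A) * (ε * A) := by nlinarith
    have h4 := le_of_mul_le_mul_left h3 hεA
    have h5 : ε * A ≤ t := by linarith
    have h6 : (ε * A) * x0 ≤ (ε * A) * (ε * A) := by nlinarith
    have := le_of_mul_le_mul_left h6 hεA
    linarith

end Final

/-- For fixed `p`, `n`, `i`, `δ` and `C` there exists `Q ≥ 0` such that for all
`q = p^h ≥ Q`, every code word of weight at most `δ·q^(2n-1)` and every `n`-space
`π` with intersection parameter `i`:
`x + t ≤ C·q^(2n-1)` or `x + t ≥ Σ_(n,i) - C·q^(2n-1)`. -/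
theorem stmt16 (p n : ℕ) (hp : p.Prime) (hn : 2 ≤ n) (i : ℤ)
    (hi1 : -1 ≤ i) (hi2 : i ≤ (n:ℤ) - 2)
    (δ C : ℝ) (hδ : 0 < δ) (hC : 0 < C) :
    ∃ Q : ℝ, 0 ≤ Q ∧
      ∀ (hh q : ℕ), q = p ^ hh → Q ≤ (q:ℝ) →
      ∀ (F : Type) [Field F] [Fintype F], Fintype.card F = q ^ 2 →
      ∀ c : Submodule F (Fin (2*n+2) → F) → ZMod p,
        IsCodeword p q n c → (wt c : ℝ) ≤ δ * (q:ℝ)^(2*n-1) →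
      ∀ π : Submodule F (Fin (2*n+2) → F),
        Module.finrank F π = n + 1 →
        (Module.finrank F ↥(π ⊓ polar q π) : ℤ) = i + 1 →
        ((Nat.card {P : Submodule F (Fin (2*n+2) → F) //
              c P ≠ 0 ∧ P ≤ π ∧ ¬ P ≤ π ⊓ polar q π} : ℝ)
          + (Nat.card {P : Submodule F (Fin (2*n+2) → F) //
              c P ≠ 0 ∧ P ≤ polar q π ∧ ¬ P ≤ π ⊓ polar q π} : ℝ)
            ≤ C * (q:ℝ)^(2*n-1)) ∨
        ((Nat.card {P : Submodule F (Fin (2*n+2) → F) //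
              c P ≠ 0 ∧ P ≤ π ∧ ¬ P ≤ π ⊓ polar q π} : ℝ)
          + (Nat.card {P : Submodule F (Fin (2*n+2) → F) //
              c P ≠ 0 ∧ P ≤ polar q π ∧ ¬ P ≤ π ⊓ polar q π} : ℝ)
            ≥ ((SigmaNI q n i : ℚ) : ℝ) - C * (q:ℝ)^(2*n-1)) := by
  classical
  obtain ⟨r, hr⟩ : ∃ r, n = r + 1 := ⟨n - 1, by omega⟩
  set K : ℝ := 2 * 4 ^ r * δ with hK
  set ε : ℝ := min (C / 4) (1 / 2) with hε
  have hε0 : 0 < ε := lt_min (by positivity) (by norm_num)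
  have hε1 : ε ≤ C / 4 := min_le_left _ _
  have hε2 : ε ≤ 1 / 2 := min_le_right _ _
  refine ⟨max 5 (max (K / ε ^ 2) (56 / C)), by positivity, ?_⟩
  intro hh q hq hQ F _ _ hF c hc hw π hπ hi
  have hq5' : (5:ℝ) ≤ q := (le_max_left _ _).trans hQ
  have hqK : K / ε ^ 2 ≤ q := (le_max_left _ _).trans ((le_max_right _ _).trans hQ)
  have hqC : 56 / C ≤ q := (le_max_right _ _).trans ((le_max_right _ _).trans hQ)
  have hq5 : 5 ≤ q := by exact_mod_cast hq5'
  have hq0 : (0:ℝ) < q := by linarith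
  have g := good_of p hh q hp hq hq5 F hF
  have hpt : ∀ P, c P ≠ 0 → IsHermPoint q P := fun P hP => by
    by_contra h; exact hP (hc.1 P h)
  have hcomm : polar q π ⊓ polar q (polar q π) = π ⊓ polar q π := by
    rw [polar_polar g, inf_comm]
  have ex : Nat.card {P : Submodule F (Fin (2*n+2) → F) //
      c P ≠ 0 ∧ P ≤ π ∧ ¬ P ≤ π ⊓ polar q π} = ((XX q π).filter fun P => c P ≠ 0).card := by
    rw [Nat.card_eq_fintype_card, Fintype.card_subtype]
    congr 1
    ext P
    simp only [XX, Finset.mem_filter, Finset.mem_univ, true_and]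
    have := hpt P
    tauto
  have et : Nat.card {P : Submodule F (Fin (2*n+2) → F) //
      c P ≠ 0 ∧ P ≤ polar q π ∧ ¬ P ≤ π ⊓ polar q π}
      = ((XX q (polar q π)).filter fun P => c P ≠ 0).card := by
    rw [Nat.card_eq_fintype_card, Fintype.card_subtype]
    congr 1
    ext P
    simp only [XX, Finset.mem_filter, Finset.mem_univ, true_and]
    rw [hcomm]
    have := hpt P
    tauto
  rw [ex, et]
  have hpol := finrank_polar g π
  have k1 := card_XX g hr hπ (by omega)
  have k2 := card_XX g hr (π := polar q π) (by omega) (by rw [hcomm]; omega)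
  have k3 := key g hr hπ hc hn
  have s1 := Finset.card_filter_add_card_filter_not (s := XX q π) (fun P => c P ≠ 0)
  have s2 := Finset.card_filter_add_card_filter_not (s := XX q (polar q π)) (fun P => c P ≠ 0)
  simp only [not_not] at s1 s2
  have hsig := sigma_le hq5 n i hi1 hi2
  have f1 : 2 * n - 1 = 2 * r + 1 := by omega
  have f2 : 2 * n - 2 = 2 * r := by omega
  rw [f1, f2] at hsig
  rw [f1] at hw ⊢
  have hsig' : ((SigmaNI q n i : ℚ) : ℝ) ≤ 2 * (q:ℝ)^(2*r+1) + 28 * (q:ℝ)^(2*r) := by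
    exact_mod_cast hsig
  generalize ((XX q π).filter fun P => c P ≠ 0).card = x at *
  generalize ((XX q (polar q π)).filter fun P => c P ≠ 0).card = t at *
  generalize ((XX q π).filter fun P => c P = 0).card = x0 at *
  generalize ((XX q (polar q π)).filter fun P => c P = 0).card = t0 at *
  have hA : (0:ℝ) < (q:ℝ)^(2*r+1) := by positivity
  have hAq : (q:ℝ)^(2*r) = (q:ℝ)^(2*r+1) / q := by rw [pow_succ]; field_simp
  have hM : (q:ℝ)^(2*r+1) ≤ (x:ℝ) + x0 := by rw [← s1] at k1; exact_mod_cast k1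
  have hM' : (q:ℝ)^(2*r+1) ≤ (t:ℝ) + t0 := by rw [← s2] at k2; exact_mod_cast k2
  have hk : (x:ℝ) * t0 + x0 * t ≤ 2 * 4 ^ r * ((wt c : ℝ) * (q:ℝ)^(2*r)) := by exact_mod_cast k3
  have hk2 : (x:ℝ) * t0 + x0 * t ≤ (K / q) * ((q:ℝ)^(2*r+1)) ^ 2 := by
    calc (x:ℝ) * t0 + x0 * t ≤ 2 * 4 ^ r * ((wt c : ℝ) * (q:ℝ)^(2*r)) := hk
      _ ≤ 2 * 4 ^ r * ((δ * (q:ℝ)^(2*r+1)) * (q:ℝ)^(2*r)) := by gcongr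
      _ = _ := by rw [hAq, hK]; ring
  have hη : K / q ≤ ε ^ 2 := by
    rw [div_le_iff₀ (by positivity)] at hqK ⊢
    linarith
  have hC2 : 28 * (q:ℝ)^(2*r) ≤ C / 2 * (q:ℝ)^(2*r+1) := by
    rw [div_le_iff₀ hC] at hqC
    have h28 : 28 ≤ C / 2 * q := by linarith
    calc 28 * (q:ℝ)^(2*r) ≤ (C / 2 * q) * (q:ℝ)^(2*r) := by gcongr
      _ = _ := by rw [pow_succ]; ring
  have hεA : 2 * ε * (q:ℝ)^(2*r+1) ≤ C / 2 * (q:ℝ)^(2*r+1) := by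
    gcongr; linarith
  have hCA : 0 ≤ C * (q:ℝ)^(2*r+1) := by positivity
  rcases dichotomy (Nat.cast_nonneg x) (Nat.cast_nonneg t) (Nat.cast_nonneg x0)
    (Nat.cast_nonneg t0) hA hε0 hε2 hη hM hM' hk2 with h | h
  · left
    linarith
  · right
    show _ ≤ _
    linarith

end HermCode
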